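/- arXiv:0806.3592 — 2 statements merged into one kernel-verified Lean document; each statement's English description precedes it below -/
import Mathlib

section
/- For all Schwartz functions u: R^2 → R, one has ‖u‖_{L^∞(R^2)} ≲ ‖u‖_{L^2(R^2)}^{1/3} ‖∂_x u‖_{L^4(R^2)}^{2/3}. -/
open MeasureTheory Real Set
open scoped ENNReal

/-- Behaviour of `L^p` norms under the affine change of variables `z ↦ x + t • z`. -/
lemma eLpNorm_comp_add_smul {E F : Type*} [NormedAddCommGroup E] [NormedSpace ℝ E]
    [FiniteDimensional ℝ E] [MeasurableSpace E] [BorelSpace E] [NormedAddCommGroup F]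
    (μ : Measure E) [μ.IsAddHaarMeasure] {f : E → F} (hf : AEStronglyMeasurable f μ)
    {p : ℝ≥0∞} (hp : p ≠ ⊤) (x : E) {t : ℝ} (ht : t ≠ 0) :
    eLpNorm (fun z => f (x + t • z)) p μ =
      ENNReal.ofReal |(t ^ Module.finrank ℝ E)⁻¹| ^ (1 / p).toReal * eLpNorm f p μ := by
  have hmap : Measure.map (fun z : E => x + t • z) μ =
      ENNReal.ofReal |(t ^ Module.finrank ℝ E)⁻¹| • μ := by
    have h := Measure.map_map (μ := μ) (g := fun z : E => x + z) (f := fun z : E => t • z)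
      (by fun_prop) (by fun_prop)
    rw [Measure.map_addHaar_smul μ ht, Measure.map_smul, map_add_left_eq_self] at h
    exact h.symm
  have hmeas : AEStronglyMeasurable f (Measure.map (fun z : E => x + t • z) μ) := by
    rw [hmap]
    exact hf.smul_measure _
  have h := eLpNorm_map_measure (p := p) hmeas (by fun_prop)
  rw [hmap, eLpNorm_smul_measure_of_ne_top hp, smul_eq_mul] at h
  exact h.symm

/-- Hölder's inequality for the integral of `‖f‖` over a disc of radius `t` centred at `x`,
rescaled to the unit disc. -/
lemma integral_ball_norm_comp_add_smul_le {F : Type*} [NormedAddCommGroup F]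
    {f : EuclideanSpace ℝ (Fin 2) → F} {p : ℝ≥0∞} (hp : 1 ≤ p) (hp' : p ≠ ⊤)
    (hf : MemLp f p volume) (hfc : Continuous f) (x : EuclideanSpace ℝ (Fin 2))
    {t : ℝ} (ht : 0 < t) :
    ∫ z in Metric.ball (0 : EuclideanSpace ℝ (Fin 2)) 1, ‖f (x + t • z)‖ ≤
      (volume (Metric.ball (0 : EuclideanSpace ℝ (Fin 2)) 1)).toReal ^ (1 - 1 / p.toReal) *
        (((t ^ 2)⁻¹) ^ (1 / p.toReal) * (eLpNorm f p volume).toReal) := by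
  set B := Metric.ball (0 : EuclideanSpace ℝ (Fin 2)) 1
  have hc : Continuous fun z => f (x + t • z) := by fun_prop
  have hV : volume B ≠ ⊤ := measure_ball_lt_top.ne
  have hp1 : 1 ≤ p.toReal := by
    simpa using (ENNReal.toReal_le_toReal ENNReal.one_ne_top hp').2 hp
  have hexp : 0 ≤ 1 - 1 / p.toReal := by
    rw [sub_nonneg, div_le_one (by linarith)]
    exact hp1
  have h1 : eLpNorm (fun z => f (x + t • z)) 1 (volume.restrict B) ≤
      ENNReal.ofReal ((t ^ 2)⁻¹) ^ (1 / p.toReal) * eLpNorm f p volume *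
        volume B ^ (1 - 1 / p.toReal) := by
    refine (eLpNorm_le_eLpNorm_mul_rpow_measure_univ hp hc.aestronglyMeasurable).trans ?_
    rw [Measure.restrict_apply_univ, ENNReal.toReal_one, div_one]
    gcongr
    refine (eLpNorm_mono_measure _ Measure.restrict_le_self).trans ?_
    rw [eLpNorm_comp_add_smul volume hfc.aestronglyMeasurable hp' x ht.ne',
      finrank_euclideanSpace_fin, abs_of_pos (by positivity), ENNReal.toReal_div,
      ENNReal.toReal_one]
  rw [integral_norm_eq_lintegral_enorm hc.aestronglyMeasurable, ← eLpNorm_one_eq_lintegral_enorm]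
  refine (ENNReal.toReal_mono ?_ h1).trans_eq ?_
  · refine ENNReal.mul_ne_top (ENNReal.mul_ne_top ?_ hf.2.ne) ?_
    · exact ENNReal.rpow_ne_top_of_nonneg (by positivity) ENNReal.ofReal_ne_top
    · exact ENNReal.rpow_ne_top_of_nonneg hexp hV
  · rw [ENNReal.toReal_mul, ENNReal.toReal_mul, ← ENNReal.toReal_rpow, ← ENNReal.toReal_rpow,
      ENNReal.toReal_ofReal (by positivity)]
    ring

/-- Optimization over the scale parameter. -/
lemma le_mul_rpow_of_forall_scale {w a b A B : ℝ} (ha : 0 ≤ a) (hb : 0 ≤ b) (hA : 0 ≤ A)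
    (hB : 0 ≤ B) (h : ∀ S : ℝ, 0 < S → w ≤ A * ((S ^ 2)⁻¹ * a) + B * (b * S)) :
    w ≤ (A + B) * a ^ ((1 : ℝ) / 3) * b ^ ((2 : ℝ) / 3) := by
  have key : ∀ ε : ℝ, 0 < ε →
      w ≤ (A + B) * (a + ε) ^ ((1 : ℝ) / 3) * (b + ε) ^ ((2 : ℝ) / 3) := by
    intro ε hε
    obtain ⟨c, hc, hca⟩ : ∃ c : ℝ, 0 < c ∧ c ^ 3 = a + ε :=
      ⟨(a + ε) ^ ((1 : ℝ) / 3), by positivity, by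
        rw [← Real.rpow_natCast, ← Real.rpow_mul (by positivity)]; norm_num⟩
    obtain ⟨d, hd, hdb⟩ : ∃ d : ℝ, 0 < d ∧ d ^ 3 = b + ε :=
      ⟨(b + ε) ^ ((1 : ℝ) / 3), by positivity, by
        rw [← Real.rpow_natCast, ← Real.rpow_mul (by positivity)]; norm_num⟩
    have e1 : (a + ε) ^ ((1 : ℝ) / 3) = c := by
      rw [← hca, ← Real.rpow_natCast, ← Real.rpow_mul hc.le]; norm_num
    have e2 : (b + ε) ^ ((2 : ℝ) / 3) = d ^ 2 := by
      rw [← hdb, ← Real.rpow_natCast, ← Real.rpow_mul hd.le, ← Real.rpow_natCast]; norm_num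
    rw [e1, e2]
    calc w ≤ A * (((c / d) ^ 2)⁻¹ * a) + B * (b * (c / d)) := h (c / d) (by positivity)
      _ ≤ A * (((c / d) ^ 2)⁻¹ * c ^ 3) + B * (d ^ 3 * (c / d)) := by
        gcongr <;> linarith
      _ = (A + B) * c * d ^ 2 := by field_simp
  have hcont : Continuous fun ε : ℝ =>
      (A + B) * (a + ε) ^ ((1 : ℝ) / 3) * (b + ε) ^ ((2 : ℝ) / 3) := by
    have h1 : Continuous fun y : ℝ => y ^ ((1 : ℝ) / 3) :=
      Real.continuous_rpow_const (by norm_num)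
    have h2 : Continuous fun y : ℝ => y ^ ((2 : ℝ) / 3) :=
      Real.continuous_rpow_const (by norm_num)
    exact (continuous_const.mul (h1.comp (by fun_prop : Continuous fun ε : ℝ => a + ε))).mul
      (h2.comp (by fun_prop : Continuous fun ε : ℝ => b + ε))
  have hlim := (hcont.tendsto 0).mono_left (nhdsWithin_le_nhds (s := Ioi 0))
  simp only [add_zero] at hlim
  exact ge_of_tendsto hlim (Filter.eventually_of_mem self_mem_nhdsWithin key)

/-- Derivative of the disc means `s ↦ ∫_{B₁} u (x + s² z) dz`. -/
lemma hasDerivAt_integral_ball_comp_add_sq_smul (u : SchwartzMap (EuclideanSpace ℝ (Fin 2)) ℝ)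
    (x : EuclideanSpace ℝ (Fin 2)) (s : ℝ) :
    HasDerivAt
      (fun s : ℝ => ∫ z in Metric.ball (0 : EuclideanSpace ℝ (Fin 2)) 1, u (x + s ^ 2 • z))
      (∫ z in Metric.ball (0 : EuclideanSpace ℝ (Fin 2)) 1,
        fderiv ℝ u (x + s ^ 2 • z) ((2 * s) • z)) s := by
  set M := SchwartzMap.seminorm ℝ 0 0 (SchwartzMap.fderivCLM ℝ (EuclideanSpace ℝ (Fin 2)) ℝ u)
  have hM : ∀ y, ‖fderiv ℝ u y‖ ≤ M := fun y =>
    SchwartzMap.norm_le_seminorm ℝ (SchwartzMap.fderivCLM ℝ (EuclideanSpace ℝ (Fin 2)) ℝ u) y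
  have hM0 : 0 ≤ M := (norm_nonneg _).trans (hM 0)
  have hDc : Continuous (fderiv ℝ u) :=
    (SchwartzMap.fderivCLM ℝ (EuclideanSpace ℝ (Fin 2)) ℝ u).continuous
  have huc : Continuous u := u.continuous
  have : IsFiniteMeasure
      (volume.restrict (Metric.ball (0 : EuclideanSpace ℝ (Fin 2)) 1)) :=
    ⟨by rw [Measure.restrict_apply_univ]; exact measure_ball_lt_top⟩
  refine (hasDerivAt_integral_of_dominated_loc_of_deriv_le
    (F := fun (s : ℝ) z => u (x + s ^ 2 • z))
    (F' := fun (s : ℝ) z => fderiv ℝ u (x + s ^ 2 • z) ((2 * s) • z))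
    (bound := fun _ => M * (2 * (|s| + 1)))
    (Metric.ball_mem_nhds s one_pos) (Filter.Eventually.of_forall fun r => ?_) ?_ ?_ ?_
    (integrable_const _) ?_).2
  · exact (by fun_prop : Continuous fun z => u (x + r ^ 2 • z)).aestronglyMeasurable
  · refine Integrable.of_bound
      (by fun_prop : Continuous fun z => u (x + s ^ 2 • z)).aestronglyMeasurable
      (SchwartzMap.seminorm ℝ 0 0 u) (Filter.Eventually.of_forall fun z => ?_)
    exact SchwartzMap.norm_le_seminorm ℝ u _
  · exact (by fun_prop : Continuous fun z =>
      fderiv ℝ u (x + s ^ 2 • z) ((2 * s) • z)).aestronglyMeasurable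
  · filter_upwards [ae_restrict_mem measurableSet_ball] with z hz r hr
    have hz' : ‖z‖ ≤ 1 := (mem_ball_zero_iff.1 hz).le
    have hr' : |r| ≤ |s| + 1 := by
      have h1 : |r - s| < 1 := by simpa [Real.dist_eq] using hr
      have h2 := abs_sub_abs_le_abs_sub r s
      linarith
    calc ‖fderiv ℝ u (x + r ^ 2 • z) ((2 * r) • z)‖
        ≤ ‖fderiv ℝ u (x + r ^ 2 • z)‖ * ‖(2 * r) • z‖ := ContinuousLinearMap.le_opNorm _ _
      _ = ‖fderiv ℝ u (x + r ^ 2 • z)‖ * (2 * |r| * ‖z‖) := by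
        rw [norm_smul, norm_mul, Real.norm_eq_abs, Real.norm_eq_abs, abs_two]
      _ ≤ M * (2 * (|s| + 1) * 1) := by gcongr; exact hM _
      _ = M * (2 * (|s| + 1)) := by ring
  · refine Filter.Eventually.of_forall fun z r _ => ?_
    have hg : HasDerivAt (fun r : ℝ => x + r ^ 2 • z) ((2 * r) • z) r := by
      simpa using ((hasDerivAt_pow 2 r).smul_const z).const_add x
    exact u.differentiableAt.hasFDerivAt.comp_hasDerivAt r hg

/-- Comparison of a point value with the mean over a disc of radius `S ^ 2`. -/
lemma volume_ball_mul_abs_le (u : SchwartzMap (EuclideanSpace ℝ (Fin 2)) ℝ)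
    (x : EuclideanSpace ℝ (Fin 2)) {S : ℝ} (hS : 0 < S) :
    (volume (Metric.ball (0 : EuclideanSpace ℝ (Fin 2)) 1)).toReal * |u x| ≤
      (volume (Metric.ball (0 : EuclideanSpace ℝ (Fin 2)) 1)).toReal ^ ((1 : ℝ) / 2) *
          ((S ^ 2)⁻¹ * (eLpNorm u 2 volume).toReal) +
        2 * (volume (Metric.ball (0 : EuclideanSpace ℝ (Fin 2)) 1)).toReal ^ ((3 : ℝ) / 4) *
          ((eLpNorm (fun x => ‖fderiv ℝ u x‖) 4 volume).toReal * S) := by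
  set B := Metric.ball (0 : EuclideanSpace ℝ (Fin 2)) 1
  set V := (volume B).toReal
  set b := (eLpNorm (fun x => ‖fderiv ℝ u x‖) 4 volume).toReal with hb
  have hV0 : 0 ≤ V := ENNReal.toReal_nonneg
  have hb0 : 0 ≤ b := ENNReal.toReal_nonneg
  have hDc : Continuous (fderiv ℝ u) :=
    (SchwartzMap.fderivCLM ℝ (EuclideanSpace ℝ (Fin 2)) ℝ u).continuous
  have hDL : MemLp (fderiv ℝ u) 4 volume :=
    (SchwartzMap.fderivCLM ℝ (EuclideanSpace ℝ (Fin 2)) ℝ u).memLp 4 volume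
  set h : ℝ → ℝ := fun s => ∫ z in B, u (x + s ^ 2 • z)
  have h0 : h 0 = V * u x := by
    simp [h, V, Measure.real]
  have hderiv : ∀ s ∈ Ico 0 S,
      ‖∫ z in B, fderiv ℝ u (x + s ^ 2 • z) ((2 * s) • z)‖ ≤ 2 * V ^ ((3 : ℝ) / 4) * b := by
    rintro s ⟨hs, -⟩
    rcases hs.eq_or_lt with rfl | hs
    · simp only [mul_zero, zero_smul, map_zero, integral_zero, norm_zero]
      positivity
    have hint : IntegrableOn (fun z => 2 * s * ‖fderiv ℝ u (x + s ^ 2 • z)‖) B :=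
      ((by fun_prop : Continuous fun z =>
        2 * s * ‖fderiv ℝ u (x + s ^ 2 • z)‖).continuousOn.integrableOn_compact
        (isCompact_closedBall 0 1)).mono_set Metric.ball_subset_closedBall
    have hpt : ∀ᵐ z ∂(volume.restrict B),
        ‖fderiv ℝ u (x + s ^ 2 • z) ((2 * s) • z)‖ ≤ 2 * s * ‖fderiv ℝ u (x + s ^ 2 • z)‖ := by
      filter_upwards [ae_restrict_mem measurableSet_ball] with z hz
      have hz' : ‖z‖ ≤ 1 := (mem_ball_zero_iff.1 hz).le
      calc ‖fderiv ℝ u (x + s ^ 2 • z) ((2 * s) • z)‖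
          ≤ ‖fderiv ℝ u (x + s ^ 2 • z)‖ * ‖(2 * s) • z‖ := ContinuousLinearMap.le_opNorm _ _
        _ = ‖fderiv ℝ u (x + s ^ 2 • z)‖ * (2 * s * ‖z‖) := by
          rw [norm_smul, Real.norm_of_nonneg (by positivity)]
        _ ≤ ‖fderiv ℝ u (x + s ^ 2 • z)‖ * (2 * s * 1) := by gcongr
        _ = 2 * s * ‖fderiv ℝ u (x + s ^ 2 • z)‖ := by ring
    have hH := integral_ball_norm_comp_add_smul_le (p := 4) (by norm_num) (by norm_num) hDL hDc x
      (t := s ^ 2) (by positivity)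
    have hroot : (((s ^ 2) ^ 2)⁻¹) ^ (1 / (4 : ℝ≥0∞).toReal) = s⁻¹ := by
      rw [← pow_mul, ← inv_pow, ← Real.rpow_natCast, ← Real.rpow_mul (by positivity)]
      norm_num
    have hexp : 1 - 1 / (4 : ℝ≥0∞).toReal = 3 / 4 := by norm_num
    rw [hroot, hexp, ← eLpNorm_norm (fderiv ℝ u), ← hb] at hH
    calc ‖∫ z in B, fderiv ℝ u (x + s ^ 2 • z) ((2 * s) • z)‖
        ≤ ∫ z in B, 2 * s * ‖fderiv ℝ u (x + s ^ 2 • z)‖ :=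
          norm_integral_le_of_norm_le hint hpt
      _ = 2 * s * ∫ z in B, ‖fderiv ℝ u (x + s ^ 2 • z)‖ := integral_const_mul _ _
      _ ≤ 2 * s * (V ^ ((3 : ℝ) / 4) * (s⁻¹ * b)) := by gcongr
      _ = 2 * V ^ ((3 : ℝ) / 4) * b := by field_simp
  have hmv := norm_image_sub_le_of_norm_deriv_le_segment' (f := h)
    (fun s _ => (hasDerivAt_integral_ball_comp_add_sq_smul u x s).hasDerivWithinAt) hderiv S
    ⟨hS.le, le_rfl⟩
  have hend : |h S| ≤ V ^ ((1 : ℝ) / 2) * ((S ^ 2)⁻¹ * (eLpNorm u 2 volume).toReal) := by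
    have hH := integral_ball_norm_comp_add_smul_le (p := 2) (by norm_num) (by norm_num)
      (u.memLp 2) u.continuous x (t := S ^ 2) (by positivity)
    have hroot : (((S ^ 2) ^ 2)⁻¹) ^ (1 / (2 : ℝ≥0∞).toReal) = (S ^ 2)⁻¹ := by
      rw [← inv_pow, ← Real.rpow_natCast, ← Real.rpow_mul (by positivity)]
      norm_num
    have hexp : 1 - 1 / (2 : ℝ≥0∞).toReal = 1 / 2 := by norm_num
    rw [hroot, hexp] at hH
    exact (norm_integral_le_integral_norm _).trans hH
  rw [Real.norm_eq_abs, sub_zero, h0] at hmv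
  calc V * |u x| = |V * u x| := by rw [abs_mul, abs_of_nonneg hV0]
    _ ≤ |h S| + |h S - V * u x| := by
      have := abs_sub_abs_le_abs_sub (V * u x) (h S)
      rw [abs_sub_comm] at this
      linarith
    _ ≤ _ := by linarith

/-- Gagliardo–Nirenberg inequality on `ℝ²`:
`‖u‖_{L^∞} ≲ ‖u‖_{L²}^{1/3} ‖∂u‖_{L⁴}^{2/3}` for Schwartz `u`. -/
theorem gagliardo_nirenberg_sup_grad4 :
    ∃ C : ℝ, 0 < C ∧ ∀ u : SchwartzMap (EuclideanSpace ℝ (Fin 2)) ℝ,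
      (eLpNorm (⇑u) ⊤ volume).toReal ≤
        C * (eLpNorm (⇑u) 2 volume).toReal ^ ((1 : ℝ) / 3) *
          (eLpNorm (fun x => ‖fderiv ℝ (⇑u) x‖) 4 volume).toReal ^ ((2 : ℝ) / 3) := by
  set V := (volume (Metric.ball (0 : EuclideanSpace ℝ (Fin 2)) 1)).toReal
  have hV : 0 < V :=
    ENNReal.toReal_pos (Metric.measure_ball_pos _ _ one_pos).ne' measure_ball_lt_top.ne
  refine ⟨(V ^ ((1 : ℝ) / 2) + 2 * V ^ ((3 : ℝ) / 4)) / V, by positivity, fun u => ?_⟩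
  rw [eLpNorm_exponent_top]
  refine ENNReal.toReal_le_of_le_ofReal (by positivity)
    (eLpNormEssSup_le_of_ae_bound (Filter.Eventually.of_forall fun x => ?_))
  have h := le_mul_rpow_of_forall_scale ENNReal.toReal_nonneg ENNReal.toReal_nonneg
    (by positivity) (by positivity) fun S hS => volume_ball_mul_abs_le u x hS
  rw [Real.norm_eq_abs, div_mul_eq_mul_div, div_mul_eq_mul_div, le_div_iff₀ hV, mul_comm]
  exact h
end

section
/- Let φ: R^+ × R^2 → R^m be smooth, let A_i, A_s be smooth skew-symmetric m×m matrix fields with covariant derivatives D_i = ∂_i + A_i, D_s = ∂_s + A_s, and let η be a smooth R^m-valued field with η · φ ≥ 0 pointwise. Then (∂_s − Δ)|φ| ≤ |(D_s − D_iD_i)φ + η| in the sense of distributions (summation over i = 1,2). -/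
open MeasureTheory Set
open scoped RealInnerProductSpace

/-- The spatial direction `e_i` inside the domain `ℝ⁺ × ℝ²`. -/
noncomputable def spatialDir (i : Fin 2) : ℝ × EuclideanSpace ℝ (Fin 2) :=
  (0, EuclideanSpace.single i 1)

/-- The heat-temporal direction `∂_s` inside the domain `ℝ⁺ × ℝ²`. -/
noncomputable def timeDir : ℝ × EuclideanSpace ℝ (Fin 2) := (1, 0)

section Auxiliary

variable {E V : Type*} [NormedAddCommGroup E] [NormedSpace ℝ E]
  [NormedAddCommGroup V]

/-- Directional derivatives of smooth maps are smooth. -/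
theorem contDiff_fderiv_apply_const {W : Type*} [NormedAddCommGroup W] [NormedSpace ℝ W]
    {f : E → W} (hf : ContDiff ℝ (⊤ : ℕ∞) f) (v : E) :
    ContDiff ℝ (⊤ : ℕ∞) (fun z => fderiv ℝ f z v) :=
  (hf.fderiv_right (by simp)).clm_apply contDiff_const

/-- The regularized norm `√(‖u‖² + ε²)`. -/
noncomputable def regNorm (ε : ℝ) (u : V) : ℝ := √(‖u‖ ^ 2 + ε ^ 2)

theorem regNorm_sq (ε : ℝ) (u : V) : regNorm ε u ^ 2 = ‖u‖ ^ 2 + ε ^ 2 :=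
  Real.sq_sqrt (by positivity)

theorem regNorm_pos {ε : ℝ} (hε : 0 < ε) (u : V) : 0 < regNorm ε u :=
  Real.sqrt_pos.2 (by positivity)

theorem norm_le_regNorm (ε : ℝ) (u : V) : ‖u‖ ≤ regNorm ε u :=
  Real.le_sqrt_of_sq_le (by nlinarith [sq_nonneg ε])

theorem regNorm_le_norm_add {ε : ℝ} (hε : 0 ≤ ε) (u : V) : regNorm ε u ≤ ‖u‖ + ε :=
  Real.sqrt_le_iff.2 ⟨by positivity, by nlinarith [mul_nonneg (norm_nonneg u) hε]⟩

variable [InnerProductSpace ℝ V]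

theorem contDiff_regNorm_comp {ε : ℝ} (hε : 0 < ε) {φ : E → V} (hφ : ContDiff ℝ (⊤ : ℕ∞) φ) :
    ContDiff ℝ (⊤ : ℕ∞) (fun z => regNorm ε (φ z)) :=
  ((hφ.norm_sq ℝ).add contDiff_const).sqrt fun z => by positivity

theorem inner_self_eq_zero_of_skew {B : V →L[ℝ] V} (hB : ∀ u v, ⟪B u, v⟫ = -⟪u, B v⟫) (u : V) :
    ⟪u, B u⟫ = 0 := by
  have h := hB u u
  rw [real_inner_comm] at h
  linarith

/-- First derivative of the regularized norm in terms of a metric covariant derivative. -/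
theorem regNorm_mul_fderiv {ε : ℝ} (hε : 0 < ε) {φ : E → V} (hφ : ContDiff ℝ (⊤ : ℕ∞) φ)
    {B : V →L[ℝ] V} (hB : ∀ u v, ⟪B u, v⟫ = -⟪u, B v⟫) (z v : E) :
    regNorm ε (φ z) * fderiv ℝ (fun w => regNorm ε (φ w)) z v
      = ⟪φ z, fderiv ℝ φ z v + B (φ z)⟫ := by
  have hd : DifferentiableAt ℝ φ z := hφ.differentiable (by simp) z
  have hf : DifferentiableAt ℝ (fun w => regNorm ε (φ w)) z :=
    (contDiff_regNorm_comp hε hφ).differentiable (by simp) z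
  have hfun : (fun w => regNorm ε (φ w) * regNorm ε (φ w))
      = fun w => ⟪φ w, φ w⟫ + ε ^ 2 := by
    funext w
    rw [← sq, regNorm_sq, real_inner_self_eq_norm_sq]
  have h := congrArg (fun g => fderiv ℝ g z v) hfun
  simp only [fderiv_add_const, fderiv_inner_apply ℝ hd hd, fderiv_fun_mul hf hf] at h
  simp only [add_apply, smul_apply, smul_eq_mul,
    real_inner_comm (φ z) (fderiv ℝ φ z v)] at h
  rw [inner_add_right, inner_self_eq_zero_of_skew hB]
  linarith [real_inner_comm (φ z) (fderiv ℝ φ z v)]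

/-- Second derivative of the regularized norm in terms of a metric covariant derivative. -/
theorem regNorm_mul_fderiv_fderiv {ε : ℝ} (hε : 0 < ε) {φ : E → V}
    (hφ : ContDiff ℝ (⊤ : ℕ∞) φ) {A : E → (V →L[ℝ] V)} (hA : ContDiff ℝ (⊤ : ℕ∞) A)
    (hskew : ∀ z u v, ⟪A z u, v⟫ = -⟪u, A z v⟫) (z v : E) :
    fderiv ℝ (fun w => regNorm ε (φ w)) z v ^ 2
        + regNorm ε (φ z)
          * fderiv ℝ (fun y => fderiv ℝ (fun w => regNorm ε (φ w)) y v) z v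
      = ‖fderiv ℝ φ z v + A z (φ z)‖ ^ 2
        + ⟪φ z, fderiv ℝ (fun w => fderiv ℝ φ w v + A w (φ w)) z v
            + A z (fderiv ℝ φ z v + A z (φ z))⟫ := by
  have hreg := contDiff_regNorm_comp hε hφ
  have hcov : ContDiff ℝ (⊤ : ℕ∞) (fun w => fderiv ℝ φ w v + A w (φ w)) :=
    (contDiff_fderiv_apply_const hφ v).add (hA.clm_apply hφ)
  have hd : DifferentiableAt ℝ φ z := hφ.differentiable (by simp) z
  have hD := hcov.differentiable (by simp) z
  have hf := hreg.differentiable (by simp) z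
  have hf' := (contDiff_fderiv_apply_const hreg v).differentiable (by simp) z
  have h := congrArg (fun g => fderiv ℝ g z v)
    (funext fun w => regNorm_mul_fderiv hε hφ (hskew w) w v)
  simp only [fderiv_inner_apply ℝ hd hD, fderiv_fun_mul hf hf'] at h
  simp only [add_apply, smul_apply, smul_eq_mul] at h
  set D := fderiv ℝ φ z v + A z (φ z) with hDdef
  have hφ' : fderiv ℝ φ z v = D - A z (φ z) := by rw [hDdef]; abel
  rw [hφ', inner_sub_left, hskew, real_inner_self_eq_norm_sq] at h
  rw [inner_add_right]
  linarith

/-- A metric covariant derivative dominates the derivative of the regularized norm. -/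
theorem fderiv_regNorm_sq_le {ε : ℝ} (hε : 0 < ε) {φ : E → V} (hφ : ContDiff ℝ (⊤ : ℕ∞) φ)
    {B : V →L[ℝ] V} (hB : ∀ u v, ⟪B u, v⟫ = -⟪u, B v⟫) (z v : E) :
    fderiv ℝ (fun w => regNorm ε (φ w)) z v ^ 2 ≤ ‖fderiv ℝ φ z v + B (φ z)‖ ^ 2 := by
  have hpos := regNorm_pos hε (φ z)
  refine sq_le_sq.2 (le_of_mul_le_mul_left ?_ hpos)
  rw [abs_norm]
  calc regNorm ε (φ z) * |fderiv ℝ (fun w => regNorm ε (φ w)) z v|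
      = |⟪φ z, fderiv ℝ φ z v + B (φ z)⟫| := by
        rw [← regNorm_mul_fderiv hε hφ hB z v, abs_mul, abs_of_pos hpos]
    _ ≤ ‖φ z‖ * ‖fderiv ℝ φ z v + B (φ z)‖ := abs_real_inner_le_norm _ _
    _ ≤ _ := mul_le_mul_of_nonneg_right (norm_le_regNorm ε _) (norm_nonneg _)

/-- Pointwise diamagnetic inequality for the regularized norm. -/
theorem regNorm_heat_le {ι : Type*} [Fintype ι] {ε : ℝ} (hε : 0 < ε) {φ : E → V}
    (hφ : ContDiff ℝ (⊤ : ℕ∞) φ) {A : ι → E → (V →L[ℝ] V)}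
    (hA : ∀ i, ContDiff ℝ (⊤ : ℕ∞) (A i)) {B : V →L[ℝ] V}
    (hskew : ∀ i z u v, ⟪A i z u, v⟫ = -⟪u, A i z v⟫) (hB : ∀ u v, ⟪B u, v⟫ = -⟪u, B v⟫)
    (z t : E) (e : ι → E) {η : V} (hη : 0 ≤ ⟪η, φ z⟫) :
    fderiv ℝ (fun w => regNorm ε (φ w)) z t
        - ∑ i, fderiv ℝ (fun y => fderiv ℝ (fun w => regNorm ε (φ w)) y (e i)) z (e i)
      ≤ ‖(fderiv ℝ φ z t + B (φ z))
          - (∑ i, (fderiv ℝ (fun w => fderiv ℝ φ w (e i) + A i w (φ w)) z (e i)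
              + A i z (fderiv ℝ φ z (e i) + A i z (φ z)))) + η‖ := by
  have hpos := regNorm_pos hε (φ z)
  refine le_of_mul_le_mul_left ?_ hpos
  rw [mul_sub, regNorm_mul_fderiv hε hφ hB, Finset.mul_sum]
  have hsum : ∑ i, ⟪φ z, fderiv ℝ (fun w => fderiv ℝ φ w (e i) + A i w (φ w)) z (e i)
        + A i z (fderiv ℝ φ z (e i) + A i z (φ z))⟫
      ≤ ∑ i, regNorm ε (φ z)
          * fderiv ℝ (fun y => fderiv ℝ (fun w => regNorm ε (φ w)) y (e i)) z (e i) :=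
    Finset.sum_le_sum fun i _ => by
      linarith [regNorm_mul_fderiv_fderiv hε hφ (hA i) (hskew i) z (e i),
        fderiv_regNorm_sq_le hε hφ (hskew i z) z (e i)]
  rw [← inner_sum] at hsum
  set S := ∑ i, (fderiv ℝ (fun w => fderiv ℝ φ w (e i) + A i w (φ w)) z (e i)
    + A i z (fderiv ℝ φ z (e i) + A i z (φ z)))
  set T := fderiv ℝ φ z t + B (φ z)
  have hexp : ⟪φ z, T - S + η⟫ = ⟪φ z, T⟫ - ⟪φ z, S⟫ + ⟪η, φ z⟫ := by
    rw [inner_add_right, inner_sub_right, real_inner_comm η]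
  linarith [real_inner_le_norm (φ z) (T - S + η),
    mul_le_mul_of_nonneg_right (norm_le_regNorm ε (φ z)) (norm_nonneg (T - S + η))]

variable [MeasurableSpace E] [BorelSpace E] {μ : Measure E}

/-- The norm of a smooth map integrates against a compactly supported continuous function like the
limit of its regularizations. -/
theorem integral_norm_mul_le_of_regNorm [IsFiniteMeasureOnCompacts μ]
    {φ : E → V} (hφ : ContDiff ℝ (⊤ : ℕ∞) φ) {L : E → ℝ} (hL : Continuous L) (hc : HasCompactSupport L) {C : ℝ}
    (h : ∀ ε > 0, ∫ z, regNorm ε (φ z) * L z ∂μ ≤ C) :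
    ∫ z, ‖φ z‖ * L z ∂μ ≤ C := by
  have hLi : Integrable (fun z => |L z|) μ := (hL.integrable_of_hasCompactSupport hc).abs
  have hn : Integrable (fun z => ‖φ z‖ * L z) μ :=
    (hφ.continuous.norm.mul hL).integrable_of_hasCompactSupport hc.mul_left
  have key : ∀ ε > 0, ∫ z, ‖φ z‖ * L z ∂μ ≤ C + ε * ∫ z, |L z| ∂μ := by
    intro ε hε
    have hr : Integrable (fun z => regNorm ε (φ z) * L z) μ :=
      ((contDiff_regNorm_comp hε hφ).continuous.mul hL).integrable_of_hasCompactSupport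
        hc.mul_left
    calc ∫ z, ‖φ z‖ * L z ∂μ ≤ ∫ z, (regNorm ε (φ z) * L z + ε * |L z|) ∂μ := by
          refine integral_mono hn (hr.add (hLi.const_mul ε)) fun z => ?_
          have h1 := norm_le_regNorm ε (φ z)
          have h2 := regNorm_le_norm_add hε.le (φ z)
          have h3 : (‖φ z‖ - regNorm ε (φ z)) * L z ≤ ε * |L z| := by
            refine (le_abs_self _).trans ?_
            rw [abs_mul]
            exact mul_le_mul_of_nonneg_right (abs_le.2 ⟨by linarith, by linarith⟩) (abs_nonneg _)
          dsimp only
          linarith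
      _ = ∫ z, regNorm ε (φ z) * L z ∂μ + ε * ∫ z, |L z| ∂μ := by
          rw [integral_add hr (hLi.const_mul ε), integral_const_mul]
      _ ≤ C + ε * ∫ z, |L z| ∂μ := by linarith [h ε hε]
  have hI : 0 ≤ ∫ z, |L z| ∂μ := integral_nonneg fun z => abs_nonneg _
  refine le_of_forall_pos_le_add fun δ hδ => ?_
  refine (key (δ / (∫ z, |L z| ∂μ + 1)) (by positivity)).trans ?_
  gcongr
  rw [div_mul_eq_mul_div, div_le_iff₀ (by positivity)]
  nlinarith

variable [FiniteDimensional ℝ E] [μ.IsAddHaarMeasure]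

/-- Integration by parts against a compactly supported function. -/
theorem integral_mul_fderiv_of_hasCompactSupport {f ψ : E → ℝ} (hf : ContDiff ℝ (⊤ : ℕ∞) f)
    (hψ : ContDiff ℝ (⊤ : ℕ∞) ψ) (hc : HasCompactSupport ψ) (v : E) :
    ∫ z, f z * fderiv ℝ ψ z v ∂μ = -∫ z, fderiv ℝ f z v * ψ z ∂μ := by
  have hf' := (contDiff_fderiv_apply_const hf v).continuous
  have hψ' := (contDiff_fderiv_apply_const hψ v).continuous
  exact integral_mul_fderiv_eq_neg_fderiv_mul_of_integrable
    ((hf'.mul hψ.continuous).integrable_of_hasCompactSupport hc.mul_left)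
    ((hf.continuous.mul hψ').integrable_of_hasCompactSupport (hc.fderiv_apply (𝕜 := ℝ) v).mul_left)
    ((hf.continuous.mul hψ.continuous).integrable_of_hasCompactSupport hc.mul_left)
    (fun x _ => hf.differentiable (by simp) x) (fun x _ => hψ.differentiable (by simp) x)

/-- Moving a heat operator from a test function onto a smooth function. -/
theorem integral_mul_heat_adjoint {ι : Type*} [Fintype ι] {f ψ : E → ℝ}
    (hf : ContDiff ℝ (⊤ : ℕ∞) f) (hψ : ContDiff ℝ (⊤ : ℕ∞) ψ) (hc : HasCompactSupport ψ)
    (t : E) (e : ι → E) :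
    ∫ z, f z * (-(fderiv ℝ ψ z t)
        - ∑ i, fderiv ℝ (fun w => fderiv ℝ ψ w (e i)) z (e i)) ∂μ
      = ∫ z, (fderiv ℝ f z t
        - ∑ i, fderiv ℝ (fun w => fderiv ℝ f w (e i)) z (e i)) * ψ z ∂μ := by
  have hd {g : E → ℝ} (hg : ContDiff ℝ (⊤ : ℕ∞) g) (v : E) := contDiff_fderiv_apply_const hg v
  have hcd (v : E) : HasCompactSupport (fun z => fderiv ℝ ψ z v) := hc.fderiv_apply (𝕜 := ℝ) v
  have hleft (v : E) : Integrable (fun z => f z * fderiv ℝ ψ z v) μ :=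
    (hf.continuous.mul (hd hψ v).continuous).integrable_of_hasCompactSupport (hcd v).mul_left
  have hleft2 (v : E) :
      Integrable (fun z => f z * fderiv ℝ (fun w => fderiv ℝ ψ w v) z v) μ :=
    (hf.continuous.mul (hd (hd hψ v) v).continuous).integrable_of_hasCompactSupport
      ((hcd v).fderiv_apply (𝕜 := ℝ) v).mul_left
  have hright (v : E) : Integrable (fun z => fderiv ℝ f z v * ψ z) μ :=
    ((hd hf v).continuous.mul hψ.continuous).integrable_of_hasCompactSupport hc.mul_left
  have hright2 (v : E) :
      Integrable (fun z => fderiv ℝ (fun w => fderiv ℝ f w v) z v * ψ z) μ :=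
    ((hd (hd hf v) v).continuous.mul hψ.continuous).integrable_of_hasCompactSupport hc.mul_left
  simp only [mul_sub, sub_mul, mul_neg, Finset.mul_sum, Finset.sum_mul]
  have hneg : Integrable (fun z => -(f z * fderiv ℝ ψ z t)) μ := (hleft t).neg
  rw [integral_sub hneg (integrable_finsetSum _ fun i _ => hleft2 (e i)),
    integral_sub (hright t) (integrable_finsetSum _ fun i _ => hright2 (e i)),
    integral_neg, integral_finsetSum _ fun i _ => hleft2 (e i),
    integral_finsetSum _ fun i _ => hright2 (e i),
    integral_mul_fderiv_of_hasCompactSupport hf hψ hc, neg_neg]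
  congr 1
  refine Finset.sum_congr rfl fun i _ => ?_
  rw [integral_mul_fderiv_of_hasCompactSupport hf (hd hψ (e i)) (hcd (e i)),
    integral_mul_fderiv_of_hasCompactSupport (hd hf (e i)) hψ hc, neg_neg]

end Auxiliary

/-- Second diamagnetic inequality: for smooth `φ : ℝ⁺ × ℝ² → ℝ^m`, smooth skew-adjoint
connection coefficients `A_i, A_s` (with `D_i = ∂_i + A_i`, `D_s = ∂_s + A_s`) and a smooth
field `η` with `η · φ ≥ 0` pointwise, one has
`(∂_s − Δ)|φ| ≤ |(D_s − D_iD_i)φ + η|` in the sense of distributions on `ℝ⁺ × ℝ²`. -/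
theorem diamagnetic_inequality_heat (m : ℕ)
    (φ η : ℝ × EuclideanSpace ℝ (Fin 2) → EuclideanSpace ℝ (Fin m))
    (A : Fin 2 → ℝ × EuclideanSpace ℝ (Fin 2) →
      (EuclideanSpace ℝ (Fin m) →L[ℝ] EuclideanSpace ℝ (Fin m)))
    (As : ℝ × EuclideanSpace ℝ (Fin 2) →
      (EuclideanSpace ℝ (Fin m) →L[ℝ] EuclideanSpace ℝ (Fin m)))
    (hφ : ContDiff ℝ (⊤ : ℕ∞) φ) (hη : ContDiff ℝ (⊤ : ℕ∞) η)
    (hA : ∀ i, ContDiff ℝ (⊤ : ℕ∞) (A i)) (hAs : ContDiff ℝ (⊤ : ℕ∞) As)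
    (hskew : ∀ i z u v, ⟪A i z u, v⟫ = - ⟪u, A i z v⟫)
    (hskews : ∀ z u v, ⟪As z u, v⟫ = - ⟪u, As z v⟫)
    (hηφ : ∀ z, (0 : ℝ) ≤ ⟪η z, φ z⟫) :
    ∀ ψ : ℝ × EuclideanSpace ℝ (Fin 2) → ℝ, ContDiff ℝ (⊤ : ℕ∞) ψ → HasCompactSupport ψ →
      tsupport ψ ⊆ {z : ℝ × EuclideanSpace ℝ (Fin 2) | 0 < z.1} → (∀ z, 0 ≤ ψ z) →
      ∫ z, ‖φ z‖ * (-(fderiv ℝ ψ z timeDir)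
          - ∑ i : Fin 2, fderiv ℝ (fun w => fderiv ℝ ψ w (spatialDir i)) z (spatialDir i))
        ≤ ∫ z, ‖(fderiv ℝ φ z timeDir + As z (φ z))
            - (∑ i : Fin 2,
                (fderiv ℝ (fun w => fderiv ℝ φ w (spatialDir i) + A i w (φ w)) z (spatialDir i)
                  + A i z (fderiv ℝ φ z (spatialDir i) + A i z (φ z))))
            + η z‖ * ψ z := by
  intro ψ hψ hc _ hψ0
  have : (volume : Measure (ℝ × EuclideanSpace ℝ (Fin 2))).IsAddHaarMeasure :=
    inferInstanceAs ((volume : Measure ℝ).prod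
      (volume : Measure (EuclideanSpace ℝ (Fin 2)))).IsAddHaarMeasure
  have hcd (v) : HasCompactSupport (fun z => fderiv ℝ ψ z v) := hc.fderiv_apply (𝕜 := ℝ) v
  refine integral_norm_mul_le_of_regNorm hφ ?_ ?_ fun ε hε => ?_
  · exact (contDiff_fderiv_apply_const hψ _).continuous.neg.sub
      (continuous_finsetSum _ fun i _ =>
        (contDiff_fderiv_apply_const (contDiff_fderiv_apply_const hψ _) _).continuous)
  · simp only [Fin.sum_univ_two]
    exact (hcd _).neg.sub
      (((hcd _).fderiv_apply (𝕜 := ℝ) _).add ((hcd _).fderiv_apply (𝕜 := ℝ) _))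
  · have hreg := contDiff_regNorm_comp hε hφ
    rw [integral_mul_heat_adjoint hreg hψ hc]
    refine integral_mono ?_ ?_ fun z => mul_le_mul_of_nonneg_right
      (regNorm_heat_le hε hφ hA hskew (hskews z) z timeDir spatialDir (hηφ z)) (hψ0 z)
    · refine Continuous.integrable_of_hasCompactSupport (.mul (.sub ?_ ?_) hψ.continuous)
        hc.mul_left
      · exact (contDiff_fderiv_apply_const hreg _).continuous
      · exact continuous_finsetSum _ fun i _ =>
          (contDiff_fderiv_apply_const (contDiff_fderiv_apply_const hreg _) _).continuous
    · have hcov (i) : ContDiff ℝ (⊤ : ℕ∞)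
          (fun w => fderiv ℝ φ w (spatialDir i) + A i w (φ w)) :=
        (contDiff_fderiv_apply_const hφ _).add ((hA i).clm_apply hφ)
      refine Continuous.integrable_of_hasCompactSupport
        (.mul (.norm (.add (.sub ?_ ?_) hη.continuous)) hψ.continuous) hc.mul_left
      · exact ((contDiff_fderiv_apply_const hφ _).add (hAs.clm_apply hφ)).continuous
      · exact continuous_finsetSum _ fun i _ =>
          ((contDiff_fderiv_apply_const (hcov i) _).add ((hA i).clm_apply (hcov i))).continuous
end
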